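/- Let (X, 𝓕) be a measurable space, μ a σ-finite measure on it, 𝓕^fin = {A ∈ 𝓕 : μ(A) < ∞}, let (Ω, 𝓒, ℙ) be a probability space, and let W : 𝓕^fin → L²(Ω, ℙ; ℝ) satisfy E[W_A · W_B] = μ(A ∩ B) for all A, B ∈ 𝓕^fin. Then there exists a unique linear isometry V : L²(X, μ; ℝ) → L²(Ω, ℙ; ℝ) such that V(1_A) = W_A for every A ∈ 𝓕^fin. -/

import Mathlib

open MeasureTheory

/-- Itô isometry: given a `μ`-Brownian motion `W` with covariance
`E[W_A W_B] = μ(A ∩ B)`, there is a unique linear isometry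
`V : L²(X, μ) → L²(Ω, P)` with `V(1_A) = W_A` for all sets `A` of finite measure. -/
theorem stmt9 {X : Type*} [MeasurableSpace X] (μ : Measure X) [SigmaFinite μ]
    {Ω : Type*} [MeasurableSpace Ω] (P : Measure Ω) [IsProbabilityMeasure P]
    (W : Set X → Lp ℝ 2 P)
    (hW : ∀ A B : Set X, MeasurableSet A → MeasurableSet B → μ A < ⊤ → μ B < ⊤ →
      ∫ ω, W A ω * W B ω ∂P = (μ (A ∩ B)).toReal) :
    ∃! V : Lp ℝ 2 μ →ₗᵢ[ℝ] Lp ℝ 2 P,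
      ∀ (A : Set X) (hA : MeasurableSet A) (hfin : μ A ≠ ⊤),
        V (indicatorConstLp 2 hA hfin (1 : ℝ)) = W A := by
  classical
  let I := {A : Set X // MeasurableSet A ∧ μ A ≠ ⊤}
  let u : I → Lp ℝ 2 μ := fun A => indicatorConstLp 2 A.2.1 A.2.2 (1 : ℝ)
  let w : I → Lp ℝ 2 P := fun A => W A.1
  let e : (I →₀ ℝ) →ₗ[ℝ] Lp ℝ 2 μ := Finsupp.linearCombination ℝ u
  let f : (I →₀ ℝ) →ₗ[ℝ] Lp ℝ 2 P := Finsupp.linearCombination ℝ w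
  have hinner : ∀ A B : I, inner ℝ (w A) (w B) = inner ℝ (u A) (u B) := by
    intro A B
    have h1 := hW A.1 B.1 A.2.1 B.2.1 (lt_top_iff_ne_top.2 A.2.2) (lt_top_iff_ne_top.2 B.2.2)
    have h2 := L2.real_inner_indicatorConstLp_one_indicatorConstLp_one
      A.2.1 B.2.1 A.2.2 B.2.2
    rw [h2, L2.inner_def, Measure.real, ← h1]
    refine integral_congr_ae (Filter.Eventually.of_forall fun ω => ?_)
    simp [w, mul_comm]
  have hnorm : ∀ x, ‖f x‖ = ‖e x‖ := by
    intro x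
    rw [@norm_eq_sqrt_real_inner (Lp ℝ 2 P), @norm_eq_sqrt_real_inner (Lp ℝ 2 μ)]
    congr 1
    simp only [e, f, Finsupp.linearCombination_apply, Finsupp.sum, sum_inner, inner_sum,
      inner_smul_left, inner_smul_right, hinner]
  have hdense : DenseRange e := by
    intro g
    change g ∈ closure (Set.range e)
    rw [← LinearMap.coe_range, ← Submodule.topologicalClosure_coe, SetLike.mem_coe]
    refine Lp.induction (by norm_num)
      (motive := fun g : Lp ℝ 2 μ => g ∈ (LinearMap.range e).topologicalClosure) ?_ ?_ ?_ g
    · intro c s hs hμs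
      apply Submodule.le_topologicalClosure
      refine ⟨Finsupp.single ⟨s, hs, hμs.ne⟩ c, ?_⟩
      rw [Lp.simpleFunc.coe_indicatorConst]
      simp only [e, u, Finsupp.linearCombination_single]
      unfold indicatorConstLp
      rw [← MemLp.toLp_const_smul]
      congr 1
      ext x
      by_cases hx : x ∈ s <;> simp [hx]
    · intro f g hf hg _ h1 h2
      exact Submodule.add_mem _ h1 h2
    · exact Submodule.isClosed_topologicalClosure _
  have hle : ∃ C : ℝ, ∀ x, ‖f x‖ ≤ C * ‖e x‖ := ⟨1, fun x => by rw [hnorm, one_mul]⟩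
  have hext := LinearMap.extendOfNorm_eq hdense hle
  refine ⟨⟨(f.extendOfNorm e).toLinearMap, ?_⟩, ?_, ?_⟩
  · intro x
    refine hdense.induction_on (p := fun x => ‖f.extendOfNorm e x‖ = ‖x‖) x
      (isClosed_eq (by fun_prop) (by fun_prop)) ?_
    intro a
    rw [hext, hnorm]
  · intro A hA hfin
    have h := hext (Finsupp.single ⟨A, hA, hfin⟩ 1)
    simpa [e, f, u, w, Finsupp.linearCombination_single] using h
  · intro V hV
    have h : f.extendOfNorm e = V.toContinuousLinearMap := by
      refine LinearMap.extendOfNorm_unique hdense 1 (fun x => by rw [hnorm, one_mul]) _ ?_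
      refine Finsupp.lhom_ext fun A c => ?_
      simp [e, f, u, w, Finsupp.linearCombination_single, hV A.1 A.2.1 A.2.2]
    ext1 x
    exact (congrArg (fun T => T x) h).symm
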